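/- Suppose 0 < λ + μ < 1. Let C = J × [0, b] where J ⊂ ℝ is a finite closed interval and b > 0. Then there exist a positive integer T₀ and, for every integer T ≥ T₀, a non-trivial (nonzero) measure ν_T on S such that C is ν_T-small: for every x ∈ C and every Borel set B ⊆ S, P^T(x, B) ≥ ν_T(B). -/

import Mathlib

open MeasureTheory ProbabilityTheory Filter

noncomputable section

/-- One step of the dynamics, given current state `x = (R, Z)` and noise `n`:
`R' = R − λ·max(−R,0) + λ(λ+μ)Z + max(min(ζ, r* − R), −ξ) + n`,
`Z' = max(−R,0) + (1−λ−μ)Z`. -/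
def step (lam mu zeta xi rstar : ℝ) (x : ℝ × ℝ) (n : ℝ) : ℝ × ℝ :=
  (x.1 - lam * max (-x.1) 0 + lam * (lam + mu) * x.2
      + max (min zeta (rstar - x.1)) (-xi) + n,
   max (-x.1) 0 + (1 - lam - mu) * x.2)

/-- The Gaussian noise distribution `N(0, σ²)`. -/
def noise (sigma : ℝ) : Measure ℝ := gaussianReal 0 (sigma ^ 2).toNNReal

/-- The one-step transition kernel `P(x, ·)`: the law of `step x N` with `N ~ N(0, σ²)`. -/
def kerP (lam mu zeta xi rstar sigma : ℝ) (x : ℝ × ℝ) : Measure (ℝ × ℝ) :=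
  (noise sigma).map (step lam mu zeta xi rstar x)

/-- The `n`-step transition kernel `Pⁿ(x, ·)`. -/
def kerPn (lam mu zeta xi rstar sigma : ℝ) : ℕ → (ℝ × ℝ) → Measure (ℝ × ℝ)
  | 0, x => Measure.dirac x
  | n + 1, x => (kerP lam mu zeta xi rstar sigma x).bind (kerPn lam mu zeta xi rstar sigma n)

/-- Total variation distance between two measures: sup over Borel sets of the
absolute difference. -/
def tvDist (m1 m2 : Measure (ℝ × ℝ)) : ℝ :=
  ⨆ B : { B : Set (ℝ × ℝ) // MeasurableSet B }, |(m1 B).toReal - (m2 B).toReal|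

end

/-- The deterministic part of the first coordinate of `step`. -/
def stepDrift (lam mu zeta xi rstar : ℝ) (x : ℝ × ℝ) : ℝ :=
  x.1 - lam * max (-x.1) 0 + lam * (lam + mu) * x.2 + max (min zeta (rstar - x.1)) (-xi)

/-- The second coordinate of `step`, which does not depend on the noise. -/
def stepSnd (lam mu : ℝ) (x : ℝ × ℝ) : ℝ :=
  max (-x.1) 0 + (1 - lam - mu) * x.2

lemma continuous_stepDrift (lam mu zeta xi rstar : ℝ) :
    Continuous (stepDrift lam mu zeta xi rstar) := by
  unfold stepDrift
  fun_prop

lemma step_eq (lam mu zeta xi rstar : ℝ) (x : ℝ × ℝ) (n : ℝ) :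
    step lam mu zeta xi rstar x n = (stepDrift lam mu zeta xi rstar x + n, stepSnd lam mu x) :=
  rfl

lemma continuous_uncurry_step (lam mu zeta xi rstar : ℝ) :
    Continuous (fun p : (ℝ × ℝ) × ℝ ↦ step lam mu zeta xi rstar p.1 p.2) := by
  unfold step
  fun_prop

lemma measurable_step (lam mu zeta xi rstar : ℝ) (x : ℝ × ℝ) :
    Measurable (step lam mu zeta xi rstar x) := by
  unfold step
  fun_prop

instance isProbabilityMeasure_noise (sigma : ℝ) : IsProbabilityMeasure (noise sigma) := by
  unfold noise
  infer_instance

lemma measurable_kerP (lam mu zeta xi rstar sigma : ℝ) :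
    Measurable (kerP lam mu zeta xi rstar sigma) := by
  refine Measure.measurable_of_measurable_coe _ fun B hB ↦ ?_
  have h := measurable_measure_prodMk_left (ν := noise sigma)
    ((continuous_uncurry_step lam mu zeta xi rstar).measurable hB)
  convert h using 2 with x
  exact Measure.map_apply (measurable_step lam mu zeta xi rstar x) hB

lemma measurable_kerPn (lam mu zeta xi rstar sigma : ℝ) (n : ℕ) :
    Measurable (kerPn lam mu zeta xi rstar sigma n) := by
  induction n with
  | zero => exact Measure.measurable_dirac
  | succ n ih => exact (Measure.measurable_bind' ih).comp (measurable_kerP _ _ _ _ _ _)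

lemma kerPn_succ_apply (lam mu zeta xi rstar sigma : ℝ) (n : ℕ) (x : ℝ × ℝ)
    {B : Set (ℝ × ℝ)} (hB : MeasurableSet B) :
    kerPn lam mu zeta xi rstar sigma (n + 1) x B
      = ∫⁻ y, kerPn lam mu zeta xi rstar sigma n y B ∂kerP lam mu zeta xi rstar sigma x :=
  Measure.bind_apply hB (measurable_kerPn _ _ _ _ _ _ n).aemeasurable

lemma kerPn_one (lam mu zeta xi rstar sigma : ℝ) :
    kerPn lam mu zeta xi rstar sigma 1 = kerP lam mu zeta xi rstar sigma := by
  funext x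
  exact Measure.bind_dirac

/-- A Gaussian translated by a bounded amount dominates a fixed multiple of Lebesgue measure
on a bounded interval. -/
lemma exists_mul_setLIntegral_le_lintegral_noise {sigma : ℝ} (hsigma : 0 < sigma) (L K : ℝ) :
    ∃ c : ENNReal, c ≠ 0 ∧ ∀ m : ℝ, |m| ≤ K → ∀ f : ℝ → ENNReal, Measurable f →
      c * ∫⁻ r in Set.Icc (-L) L, f r ≤ ∫⁻ n, f (m + n) ∂noise sigma := by
  set v : NNReal := (sigma ^ 2).toNNReal
  have hv : v ≠ 0 := (Real.toNNReal_pos.2 (by positivity)).ne'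
  refine ⟨gaussianPDF 0 v (L + K), (gaussianPDF_pos 0 hv _).ne', fun m hm f hf ↦ ?_⟩
  have hpdf : ∀ r ∈ Set.Icc (-L) L, gaussianPDF 0 v (L + K) ≤ gaussianPDF 0 v (-m + r) := by
    intro r hr
    refine ENNReal.ofReal_le_ofReal ?_
    simp only [gaussianPDFReal, sub_zero]
    have hsq : (-m + r) ^ 2 ≤ (L + K) ^ 2 := by
      have := abs_le.1 hm
      apply sq_le_sq'
      · linarith [hr.1]
      · linarith [hr.2]
    gcongr
  calc gaussianPDF 0 v (L + K) * ∫⁻ r in Set.Icc (-L) L, f r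
      = ∫⁻ r in Set.Icc (-L) L, gaussianPDF 0 v (L + K) * f r := (lintegral_const_mul _ hf).symm
    _ ≤ ∫⁻ r in Set.Icc (-L) L, gaussianPDF 0 v (-m + r) * f r :=
        setLIntegral_mono' measurableSet_Icc fun r hr ↦ by gcongr; exact hpdf r hr
    _ ≤ ∫⁻ r, gaussianPDF 0 v (-m + r) * f r := setLIntegral_le_lintegral _ _
    _ = ∫⁻ n, gaussianPDF 0 v n * f (m + n) := by
        rw [← lintegral_add_left_eq_self _ m]
        simp
    _ = ∫⁻ n, f (m + n) ∂noise sigma := by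
        rw [noise, gaussianReal_of_var_ne_zero 0 hv,
          lintegral_withDensity_eq_lintegral_mul _ (measurable_gaussianPDF 0 v)
            (show Measurable fun n ↦ f (m + n) from hf.comp (measurable_const_add m))]
        rfl

/-- On a compact set the one-step kernel dominates, uniformly, a multiple of Lebesgue measure on a
bounded interval of the horizontal line through `stepSnd x`. -/
lemma exists_mul_setLIntegral_le_lintegral_kerP (lam mu zeta xi rstar : ℝ) {sigma : ℝ}
    (hsigma : 0 < sigma) {C : Set (ℝ × ℝ)} (hC : IsCompact C) (L : ℝ) :
    ∃ c : ENNReal, c ≠ 0 ∧ ∀ x ∈ C, ∀ f : ℝ × ℝ → ENNReal, Measurable f →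
      c * ∫⁻ r in Set.Icc (-L) L, f (r, stepSnd lam mu x)
        ≤ ∫⁻ y, f y ∂kerP lam mu zeta xi rstar sigma x := by
  obtain ⟨K, hK⟩ := hC.exists_bound_of_continuousOn
    (continuous_stepDrift lam mu zeta xi rstar).continuousOn
  obtain ⟨c, hc, hle⟩ := exists_mul_setLIntegral_le_lintegral_noise hsigma L K
  refine ⟨c, hc, fun x hx f hf ↦ ?_⟩
  rw [kerP, lintegral_map hf (measurable_step _ _ _ _ _ x)]
  exact hle _ (hK x hx) (fun r ↦ f (r, stepSnd lam mu x)) (hf.comp measurable_prodMk_right)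

lemma exists_stepSnd_mem_Icc {lam mu : ℝ} (hlm1 : lam + mu < 1) (j1 j2 b : ℝ) :
    ∃ H : ℝ, 0 ≤ H ∧ ∀ x ∈ Set.Icc j1 j2 ×ˢ Set.Icc (0 : ℝ) b,
      stepSnd lam mu x ∈ Set.Icc 0 H := by
  have ha : 0 < 1 - lam - mu := by linarith
  refine ⟨|j1| + (1 - lam - mu) * |b|, by positivity, ?_⟩
  rintro ⟨r, z⟩ ⟨hr, hz⟩
  have hz0 : 0 ≤ z := hz.1
  refine ⟨by unfold stepSnd; positivity, add_le_add ?_ ?_⟩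
  · exact max_le (by linarith [hr.1, neg_abs_le j1]) (abs_nonneg _)
  · exact mul_le_mul_of_nonneg_left (hz.2.trans (le_abs_self b)) ha.le

lemma rectangle_isSmall_two (lam mu zeta xi rstar : ℝ) {sigma : ℝ}
    (hsigma : 0 < sigma) (hlm1 : lam + mu < 1) (j1 j2 b : ℝ) :
    ∃ ν : Measure (ℝ × ℝ), ν ≠ 0 ∧
      ∀ x ∈ Set.Icc j1 j2 ×ˢ Set.Icc (0 : ℝ) b, ∀ B : Set (ℝ × ℝ), MeasurableSet B →
        ν B ≤ kerPn lam mu zeta xi rstar sigma 2 x B := by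
  obtain ⟨H, hH, hsnd⟩ := exists_stepSnd_mem_Icc hlm1 j1 j2 b
  set a : ℝ := 1 - lam - mu with ha_def
  have ha : 0 < a := by linarith
  set L : ℝ := a * H + 1 with hL
  obtain ⟨c₁, hc₁, h₁⟩ := exists_mul_setLIntegral_le_lintegral_kerP lam mu zeta xi rstar hsigma
    ((isCompact_Icc (a := j1) (b := j2)).prod (isCompact_Icc (a := (0 : ℝ)) (b := b))) L
  obtain ⟨c₂, hc₂, h₂⟩ := exists_mul_setLIntegral_le_lintegral_kerP lam mu zeta xi rstar hsigma
    ((isCompact_Icc (a := -L) (b := 0)).prod (isCompact_Icc (a := (0 : ℝ)) (b := H))) 1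
  set I : Set ℝ := Set.Icc (-1) 1
  set J : Set ℝ := Set.Icc (a * H) (a * H + 1)
  set ρ : Measure (ℝ × ℝ) := (volume.restrict I).prod (volume.restrict J)
  refine ⟨(c₁ * c₂) • ρ, ?_, fun x hx B hB ↦ ?_⟩
  · intro h
    have := congrArg (fun m : Measure (ℝ × ℝ) ↦ m Set.univ) h
    simp [ρ, I, J, ← Set.univ_prod_univ, Measure.prod_prod, hc₁, hc₂] at this
    norm_num at this
  set h : ℝ := stepSnd lam mu x
  obtain ⟨hh0, hhH⟩ : 0 ≤ h ∧ h ≤ H := hsnd x hx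
  set g : ℝ → ENNReal := fun z ↦ (volume.restrict I) ((fun r ↦ (r, z)) ⁻¹' B)
  have hg : Measurable g := measurable_measure_prodMk_right hB
  have hmeas : Measurable fun y ↦ kerPn lam mu zeta xi rstar sigma 1 y B :=
    (Measure.measurable_coe hB).comp (measurable_kerPn _ _ _ _ _ _ 1)
  have hinner : ∀ r ∈ Set.Icc (-L) 0,
      c₂ * g (a * h - r) ≤ kerPn lam mu zeta xi rstar sigma 1 (r, h) B := by
    intro r hr
    have key := h₂ (r, h) ⟨hr, hh0, hhH⟩ (B.indicator 1) (measurable_one.indicator hB)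
    rw [lintegral_indicator_one hB] at key
    have hs : stepSnd lam mu (r, h) = a * h - r := by
      simp only [stepSnd, max_eq_left (neg_nonneg.2 hr.2), ← ha_def]
      ring
    have hi : ∫⁻ s in I, B.indicator (1 : ℝ × ℝ → ENNReal) (s, a * h - r) = g (a * h - r) :=
      lintegral_indicator_one (measurable_prodMk_right hB)
    rw [hs, hi] at key
    rwa [kerPn_one]
  calc ((c₁ * c₂) • ρ) B = c₁ * (c₂ * ∫⁻ z in J, g z) := by
        rw [Measure.smul_apply, Measure.prod_apply_symm hB, smul_eq_mul, mul_assoc]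
    _ ≤ c₁ * (c₂ * ∫⁻ r in Set.Icc (-L) 0, g (a * h - r)) := by
        gcongr c₁ * (c₂ * ?_)
        rw [← lintegral_indicator measurableSet_Icc, ← lintegral_indicator measurableSet_Icc,
          ← lintegral_sub_left_eq_self (J.indicator g) (a * h)]
        refine lintegral_mono fun r ↦ Set.indicator_apply_le' (fun hr ↦ ?_) fun _ ↦ zero_le
        have hah : a * h ≤ a * H := mul_le_mul_of_nonneg_left hhH ha.le
        have hah0 : 0 ≤ a * h := mul_nonneg ha.le hh0
        have hmem : r ∈ Set.Icc (-L) 0 := ⟨by linarith [hr.2], by linarith [hr.1]⟩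
        rw [Set.indicator_of_mem hmem]
    _ = c₁ * ∫⁻ r in Set.Icc (-L) 0, c₂ * g (a * h - r) := by
        rw [lintegral_const_mul _
          (show Measurable fun r ↦ g (a * h - r) from hg.comp (measurable_const_sub _))]
    _ ≤ c₁ * ∫⁻ r in Set.Icc (-L) 0, kerPn lam mu zeta xi rstar sigma 1 (r, h) B := by
        gcongr c₁ * ?_
        exact setLIntegral_mono' measurableSet_Icc hinner
    _ ≤ c₁ * ∫⁻ r in Set.Icc (-L) L, kerPn lam mu zeta xi rstar sigma 1 (r, h) B := by
        gcongr
        positivity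
    _ ≤ kerPn lam mu zeta xi rstar sigma 2 x B := by
        rw [kerPn_succ_apply _ _ _ _ _ _ 1 x hB]
        exact h₁ x hx _ hmeas

lemma rectangle_isSmall_add_two (lam mu zeta xi rstar : ℝ) {sigma : ℝ}
    (hsigma : 0 < sigma) (hlm1 : lam + mu < 1) (n : ℕ) (j1 j2 b : ℝ) :
    ∃ ν : Measure (ℝ × ℝ), ν ≠ 0 ∧
      ∀ x ∈ Set.Icc j1 j2 ×ˢ Set.Icc (0 : ℝ) b, ∀ B : Set (ℝ × ℝ), MeasurableSet B →
        ν B ≤ kerPn lam mu zeta xi rstar sigma (n + 2) x B := by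
  induction n generalizing j1 j2 b with
  | zero => exact rectangle_isSmall_two lam mu zeta xi rstar hsigma hlm1 j1 j2 b
  | succ n ih =>
    obtain ⟨H, -, hsnd⟩ := exists_stepSnd_mem_Icc hlm1 j1 j2 b
    obtain ⟨ν, hν, hsmall⟩ := ih (-1) 1 H
    obtain ⟨c, hc, hle⟩ := exists_mul_setLIntegral_le_lintegral_kerP lam mu zeta xi rstar hsigma
      ((isCompact_Icc (a := j1) (b := j2)).prod (isCompact_Icc (a := (0 : ℝ)) (b := b))) 1
    set I : Set ℝ := Set.Icc (-1) 1
    have hI : volume I ≠ 0 := by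
      simp only [I, Real.volume_Icc]
      norm_num
    refine ⟨(c * volume I) • ν, ?_, fun x hx B hB ↦ ?_⟩
    · intro h
      refine hν (Measure.measure_univ_eq_zero.1 ?_)
      have := congrArg (fun m : Measure (ℝ × ℝ) ↦ m Set.univ) h
      simpa [hc, hI] using this
    have hmeas : Measurable fun y ↦ kerPn lam mu zeta xi rstar sigma (n + 2) y B :=
      (Measure.measurable_coe hB).comp (measurable_kerPn _ _ _ _ _ _ _)
    calc ((c * volume I) • ν) B = c * ∫⁻ _ in I, ν B := by
          rw [setLIntegral_const, Measure.smul_apply, smul_eq_mul, mul_comm (ν B), mul_assoc]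
      _ ≤ c * ∫⁻ r in I, kerPn lam mu zeta xi rstar sigma (n + 2) (r, stepSnd lam mu x) B := by
          gcongr c * ?_
          exact setLIntegral_mono' measurableSet_Icc fun r hr ↦ hsmall _ ⟨hr, hsnd x hx⟩ B hB
      _ ≤ kerPn lam mu zeta xi rstar sigma (n + 1 + 2) x B := by
          rw [kerPn_succ_apply _ _ _ _ _ _ (n + 2) x hB]
          exact hle x hx _ hmeas

/-- Lemma 3.3, smallness. Suppose `0 < λ + μ < 1`. For any set
`C = J × [0, b]` with `J = [j₁, j₂]` a finite closed interval and `b > 0`, there exist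
`T₀ > 0` and, for every `T ≥ T₀`, a non-trivial measure `ν_T` such that `C` is `ν_T`-small:
`P^T(x, B) ≥ ν_T(B)` for all `x ∈ C` and all Borel `B`. -/
theorem rectangle_is_small
    (lam mu zeta xi rstar sigma : ℝ)
    (hlam : 0 < lam) (hzeta : 0 < zeta) (hxi : 0 < xi) (hrstar : zeta < rstar)
    (hsigma : 0 < sigma) (hlm0 : 0 < lam + mu) (hlm1 : lam + mu < 1)
    (j1 j2 b : ℝ) (hb : 0 < b) :
    ∃ T0 : ℕ, 0 < T0 ∧
      ∀ T : ℕ, T0 ≤ T →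
        ∃ ν : Measure (ℝ × ℝ), ν ≠ 0 ∧
          ∀ x ∈ Set.Icc j1 j2 ×ˢ Set.Icc (0 : ℝ) b,
            ∀ B : Set (ℝ × ℝ), MeasurableSet B →
              ν B ≤ kerPn lam mu zeta xi rstar sigma T x B := by
  refine ⟨2, two_pos, fun T hT ↦ ?_⟩
  obtain ⟨n, rfl⟩ := Nat.exists_eq_add_of_le' hT
  exact rectangle_isSmall_add_two lam mu zeta xi rstar hsigma hlm1 n j1 j2 b
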